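/- Let F : ℝ³ × ℝ³ ≅ ℝ⁶ → ℝ be F(x, y) = (‖x‖² + ‖y‖²)² − 2·((‖x‖² − ‖y‖²)² + 4·⟨x, y⟩²), and let Φ := (1/4)·∇F : ℝ⁶ → ℝ⁶ be its gradient map. Then the restriction of Φ to the unit sphere S⁵ is not injective: there exist p, q ∈ S⁵ with p ≠ q and Φ(p) = Φ(q). Consequently, there is no linear isometry R : ℝ⁶ → ℝ⁶ such that Φ(p) = R(p) for all p ∈ S⁵. -/

import Mathlib

/-- Identifying `ℝ³ × ℝ³ ≅ ℝ⁶` via `p = (x, y)` with `x = (p 0, p 1, p 2)` and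
`y = (p 3, p 4, p 5)`: the squared norm `‖x‖²`. -/
def normSqX (p : EuclideanSpace ℝ (Fin 6)) : ℝ := p 0 ^ 2 + p 1 ^ 2 + p 2 ^ 2

/-- The squared norm `‖y‖²` of the second `ℝ³`-factor. -/
def normSqY (p : EuclideanSpace ℝ (Fin 6)) : ℝ := p 3 ^ 2 + p 4 ^ 2 + p 5 ^ 2

/-- The Euclidean inner product `⟨x, y⟩` of the two `ℝ³`-factors. -/
def innXY (p : EuclideanSpace ℝ (Fin 6)) : ℝ := p 0 * p 3 + p 1 * p 4 + p 2 * p 5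

/-- The Cartan–Münzner polynomial
`F(x, y) = (‖x‖² + ‖y‖²)² - 2((‖x‖² - ‖y‖²)² + 4⟨x, y⟩²)` on `ℝ³ × ℝ³ ≅ ℝ⁶`
(the isoparametric polynomial with `g = 4`, `m₁ = m₂ = 1`). -/
def isoparamF (p : EuclideanSpace ℝ (Fin 6)) : ℝ :=
  (normSqX p + normSqY p) ^ 2 - 2 * ((normSqX p - normSqY p) ^ 2 + 4 * innXY p ^ 2)

/-- The gradient map `Φ = (1/4) ∇F` of the isoparametric polynomial `isoparamF`. -/
noncomputable def gradMapF (p : EuclideanSpace ℝ (Fin 6)) : EuclideanSpace ℝ (Fin 6) :=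
  (4 : ℝ)⁻¹ • gradient isoparamF p

/-- The closed form of `(1/4) ∇F` in coordinates. -/
theorem gradMapF_eq (p : EuclideanSpace ℝ (Fin 6)) :
    gradMapF p =
      !₂[(3 * normSqY p - normSqX p) * p 0 - 4 * innXY p * p 3,
        (3 * normSqY p - normSqX p) * p 1 - 4 * innXY p * p 4,
        (3 * normSqY p - normSqX p) * p 2 - 4 * innXY p * p 5,
        (3 * normSqX p - normSqY p) * p 3 - 4 * innXY p * p 0,
        (3 * normSqX p - normSqY p) * p 4 - 4 * innXY p * p 1,
        (3 * normSqX p - normSqY p) * p 5 - 4 * innXY p * p 2] := by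
  have hc : ∀ i : Fin 6, HasFDerivAt (fun z : EuclideanSpace ℝ (Fin 6) => z i)
      (EuclideanSpace.proj i : EuclideanSpace ℝ (Fin 6) →L[ℝ] ℝ) p :=
    fun i => (EuclideanSpace.proj i : EuclideanSpace ℝ (Fin 6) →L[ℝ] ℝ).hasFDerivAt
  have hX : HasFDerivAt normSqX _ p :=
    (((hc 0).pow 2).add ((hc 1).pow 2)).add ((hc 2).pow 2)
  have hY : HasFDerivAt normSqY _ p :=
    (((hc 3).pow 2).add ((hc 4).pow 2)).add ((hc 5).pow 2)
  have hI : HasFDerivAt innXY _ p :=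
    (((hc 0).mul (hc 3)).add ((hc 1).mul (hc 4))).add ((hc 2).mul (hc 5))
  have hF : HasFDerivAt isoparamF _ p :=
    ((hX.add hY).pow 2).sub ((((hX.sub hY).pow 2).add ((hI.pow 2).const_mul 4)).const_mul 2)
  ext i
  have key : (gradient isoparamF p) i =
      fderiv ℝ isoparamF p (EuclideanSpace.single i (1 : ℝ)) := by
    rw [← InnerProductSpace.toDual_symm_apply (𝕜 := ℝ), EuclideanSpace.inner_single_right]
    simp [gradient]
  rw [gradMapF, PiLp.smul_apply, key, hF.fderiv]
  fin_cases i <;>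
    simp [normSqX, normSqY, innXY] <;> ring

/-- The restriction to the unit sphere `S⁵` of the gradient map
`Φ = (1/4) ∇F` of the isoparametric polynomial
`F(x, y) = (‖x‖² + ‖y‖²)² - 2((‖x‖² - ‖y‖²)² + 4⟨x, y⟩²)` on `ℝ⁶` is not injective;
consequently there is no linear isometry `R : ℝ⁶ → ℝ⁶` with `Φ(p) = R(p)` for all
`p ∈ S⁵`. -/
theorem gradMapF_not_injective_on_sphere :
    (∃ p q : EuclideanSpace ℝ (Fin 6),
        ‖p‖ = 1 ∧ ‖q‖ = 1 ∧ p ≠ q ∧ gradMapF p = gradMapF q) ∧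
      ¬∃ R : EuclideanSpace ℝ (Fin 6) →ₗᵢ[ℝ] EuclideanSpace ℝ (Fin 6),
          ∀ p : EuclideanSpace ℝ (Fin 6), ‖p‖ = 1 → gradMapF p = R p := by
  have h : ∃ p q : EuclideanSpace ℝ (Fin 6),
      ‖p‖ = 1 ∧ ‖q‖ = 1 ∧ p ≠ q ∧ gradMapF p = gradMapF q := by
    have h3 : √(3 : ℝ) ^ 2 = 3 := Real.sq_sqrt (by norm_num)
    refine ⟨!₂[1, 0, 0, 0, 0, 0], !₂[-1 / 2, 0, 0, 0, √3 / 2, 0], ?_, ?_, ?_, ?_⟩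
    · simp [EuclideanSpace.norm_eq, Fin.sum_univ_succ]
    · rw [EuclideanSpace.norm_eq, Real.sqrt_eq_one]
      simp [Fin.sum_univ_succ, div_pow]
      norm_num
    · intro h
      have h0 := congrArg (fun z : EuclideanSpace ℝ (Fin 6) => z 0) h
      norm_num at h0
    · rw [gradMapF_eq, gradMapF_eq]
      ext i
      fin_cases i <;> simp [normSqX, normSqY, innXY, div_pow] <;> norm_num
  refine ⟨h, ?_⟩
  rintro ⟨R, hR⟩
  obtain ⟨p, q, hp, hq, hne, hpq⟩ := h
  exact hne (R.injective (by rw [← hR p hp, ← hR q hq, hpq]))
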